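/- For x ∈ ℂ^{n+1}∖Σ set β(x) = (‖x‖² + h(x)^{1/2})^{1/2} (well defined and positive, since h(x) > 0 and ‖x‖ > 0 off Σ), and define Φ(x) = (q(x), u(x), v(x)) ∈ ℂ × ℝ^{n+1} × ℝ^{n+1}, where u(x) = −(1/2)·Im(x)·β(x) − (1/2)·Im(conj(q(x))·x)·β(x)^{−1} and v(x) = h(x)^{−1/2}·Re(x)·β(x) − h(x)^{−1/2}·Re(conj(q(x))·x)·β(x)^{−1}. Then Φ maps ℂ^{n+1}∖Σ bijectively onto ℂ × (T∖T(0)), and moreover ‖u(x)‖ = (1/2)·h(x)^{1/2} for every x ∈ ℂ^{n+1}∖Σ. (This is the explicit fibrewise trivialization Φ of Lemma 1.2.4, identifying the quadratic fibration q away from the Lagrangian cone Σ with the product of ℂ and the complement of the zero-section in T*S^n.) -/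

import Mathlib

/-! The explicit trivialization Φ from the proof of Lemma 1.2.4 of Seidel, "A long
exact sequence for symplectic Floer cohomology": away from the Lagrangian cone Σ, the
map Φ(x) = (q(x), u(x), v(x)) identifies ℂ^{n+1}∖Σ with ℂ × (T∖T(0)), where
T = T*Sⁿ = {(u,v) : ⟨u,v⟩ = 0, ‖v‖ = 1}; moreover ‖u(x)‖ = ½·h(x)^{1/2}. -/

noncomputable section

/-- The standard complex quadratic form `q(x) = x₁² + ⋯ + x_{n+1}²`. -/
def q (n : ℕ) (x : Fin (n+1) → ℂ) : ℂ := ∑ k, (x k)^2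

/-- `h(x) = ‖x‖⁴ − |q(x)|²`. -/
def hFun (n : ℕ) (x : Fin (n+1) → ℂ) : ℝ :=
  (∑ k, Complex.normSq (x k))^2 - Complex.normSq (q n x)

/-- The cone Σ of complex multiples of real vectors. -/
def SigmaCone (n : ℕ) : Set (Fin (n+1) → ℂ) :=
  {x | ∃ (c : ℂ) (y : Fin (n+1) → ℝ), x = fun k => c * (y k)}

/-- `β(x) = (‖x‖² + h(x)^{1/2})^{1/2}`. -/
def betaFun (n : ℕ) (x : Fin (n+1) → ℂ) : ℝ :=
  Real.sqrt ((∑ k, Complex.normSq (x k)) + Real.sqrt (hFun n x))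

/-- `u(x) = −½·Im(x)·β(x) − ½·Im(conj(q(x))·x)·β(x)⁻¹`. -/
def uMap (n : ℕ) (x : Fin (n+1) → ℂ) : Fin (n+1) → ℝ := fun k =>
  -(1/2) * (x k).im * betaFun n x
    - (1/2) * ((starRingEnd ℂ) (q n x) * x k).im * (betaFun n x)⁻¹

/-- `v(x) = h(x)^{-1/2}·Re(x)·β(x) − h(x)^{-1/2}·Re(conj(q(x))·x)·β(x)⁻¹`. -/
def vMap (n : ℕ) (x : Fin (n+1) → ℂ) : Fin (n+1) → ℝ := fun k =>
  (Real.sqrt (hFun n x))⁻¹ * (x k).re * betaFun n x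
    - (Real.sqrt (hFun n x))⁻¹ * ((starRingEnd ℂ) (q n x) * x k).re * (betaFun n x)⁻¹

/-- The trivialization `Φ(x) = (q(x), u(x), v(x))`. -/
def Phi (n : ℕ) (x : Fin (n+1) → ℂ) : ℂ × (Fin (n+1) → ℝ) × (Fin (n+1) → ℝ) :=
  (q n x, uMap n x, vMap n x)

/-- The cotangent bundle `T = T*Sⁿ = {(u,v) : ⟨u,v⟩ = 0, ‖v‖ = 1}`. -/
def TBundle (n : ℕ) : Set ((Fin (n+1) → ℝ) × (Fin (n+1) → ℝ)) :=
  {p | (∑ k, p.1 k * p.2 k) = 0 ∧ (∑ k, (p.2 k)^2) = 1}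

theorem sum_linear_comb_mul {ι : Type*} [Fintype ι] (a b : ι → ℝ) (c d e f : ℝ) :
    ∑ k, (c * a k + d * b k) * (e * a k + f * b k) =
      c * e * ∑ k, a k ^ 2 + (c * f + d * e) * ∑ k, a k * b k + d * f * ∑ k, b k ^ 2 := by
  simp only [Finset.mul_sum, ← Finset.sum_add_distrib]
  exact Finset.sum_congr rfl fun k _ => by ring

theorem sum_linear_comb_sq {ι : Type*} [Fintype ι] (a b : ι → ℝ) (c d : ℝ) :
    ∑ k, (c * a k + d * b k) ^ 2 =
      c ^ 2 * ∑ k, a k ^ 2 + 2 * c * d * ∑ k, a k * b k + d ^ 2 * ∑ k, b k ^ 2 := by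
  simp only [sq (_ + _), sum_linear_comb_mul]
  ring

theorem q_re (n : ℕ) (x : Fin (n+1) → ℂ) :
    (q n x).re = ∑ k, (x k).re ^ 2 - ∑ k, (x k).im ^ 2 := by
  simp [q, sq, Finset.sum_sub_distrib]

theorem q_im (n : ℕ) (x : Fin (n+1) → ℂ) :
    (q n x).im = 2 * ∑ k, (x k).re * (x k).im := by
  simp only [q, Complex.im_sum, Finset.mul_sum, sq, Complex.mul_im]
  exact Finset.sum_congr rfl fun k _ => by ring

theorem sum_normSq_eq {ι : Type*} [Fintype ι] (x : ι → ℂ) :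
    ∑ k, Complex.normSq (x k) = ∑ k, (x k).re ^ 2 + ∑ k, (x k).im ^ 2 := by
  simp [Complex.normSq_apply, sq, Finset.sum_add_distrib]

theorem hFun_eq (n : ℕ) (x : Fin (n+1) → ℂ) :
    hFun n x = 4 * ((∑ k, (x k).re ^ 2) * (∑ k, (x k).im ^ 2)
      - (∑ k, (x k).re * (x k).im) ^ 2) := by
  rw [hFun, Complex.normSq_apply, q_re, q_im, sum_normSq_eq]
  ring

theorem hFun_eq_zero_of_mem_SigmaCone {n : ℕ} {x : Fin (n+1) → ℂ} (hx : x ∈ SigmaCone n) :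
    hFun n x = 0 := by
  obtain ⟨c, y, rfl⟩ := hx
  have h₁ (c d : ℝ) : ∑ k, c * y k * (d * y k) = c * d * ∑ k, y k ^ 2 := by
    rw [Finset.mul_sum]
    exact Finset.sum_congr rfl fun k _ => by ring
  simp only [hFun_eq, Complex.re_mul_ofReal, Complex.im_mul_ofReal, sq (_ * y _), h₁]
  ring

theorem hFun_pos {n : ℕ} {x : Fin (n+1) → ℂ} (hx : x ∉ SigmaCone n) : 0 < hFun n x := by
  have hA : 0 < ∑ k, (x k).re ^ 2 := by
    refine (Finset.sum_nonneg fun k _ => sq_nonneg _).lt_of_ne' fun h0 => hx ?_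
    have hre := (Finset.sum_eq_zero_iff_of_nonneg fun k _ => sq_nonneg (x k).re).1 h0
    refine ⟨Complex.I, fun k => (x k).im, funext fun k => Complex.ext ?_ ?_⟩
    · simpa using hre k (Finset.mem_univ k)
    · simp
  have hsum := sum_linear_comb_sq (fun k => (x k).re) (fun k => (x k).im)
    (-∑ k, (x k).re * (x k).im) (∑ k, (x k).re ^ 2)
  have hnn : 0 < ∑ k, (-(∑ k, (x k).re * (x k).im) * (x k).re
      + (∑ k, (x k).re ^ 2) * (x k).im) ^ 2 := by
    refine (Finset.sum_nonneg fun k _ => sq_nonneg _).lt_of_ne' fun h0 => hx ?_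
    have hk := (Finset.sum_eq_zero_iff_of_nonneg fun k _ => sq_nonneg _).1 h0
    refine ⟨⟨1, (∑ k, (x k).re * (x k).im) / ∑ k, (x k).re ^ 2⟩, fun k => (x k).re,
      funext fun k => Complex.ext ?_ ?_⟩
    · simp
    · have := pow_eq_zero_iff (two_ne_zero) |>.1 (hk k (Finset.mem_univ k))
      rw [Complex.im_mul_ofReal]
      field_simp
      linarith
  rw [hFun_eq]
  rw [hsum] at hnn
  have : 0 < (∑ k, (x k).re ^ 2) * ((∑ k, (x k).re ^ 2) * (∑ k, (x k).im ^ 2)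
      - (∑ k, (x k).re * (x k).im) ^ 2) := by
    linear_combination hnn
  linarith [pos_of_mul_pos_right this hA.le]

theorem betaFun_pos {n : ℕ} {x : Fin (n+1) → ℂ} (hx : x ∉ SigmaCone n) : 0 < betaFun n x :=
  Real.sqrt_pos.2 <| add_pos_of_nonneg_of_pos
    (Finset.sum_nonneg fun _ _ => Complex.normSq_nonneg _) (Real.sqrt_pos.2 (hFun_pos hx))

theorem betaFun_sq (n : ℕ) (x : Fin (n+1) → ℂ) :
    betaFun n x ^ 2 = ∑ k, (x k).re ^ 2 + ∑ k, (x k).im ^ 2 + √(hFun n x) := by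
  rw [betaFun, Real.sq_sqrt (add_nonneg
    (Finset.sum_nonneg fun k _ => Complex.normSq_nonneg _) (Real.sqrt_nonneg _)), sum_normSq_eq]

/-- `β` as a function of `q` and `s = h^{1/2}` alone. -/
theorem betaFun_eq (n : ℕ) (x : Fin (n+1) → ℂ) :
    betaFun n x = √(√(Complex.normSq (q n x) + hFun n x) + √(hFun n x)) := by
  rw [hFun, add_sub_cancel,
    Real.sqrt_sq (Finset.sum_nonneg fun k _ => Complex.normSq_nonneg _)]
  rfl

theorem uMap_eq {n : ℕ} {x : Fin (n+1) → ℂ} (hβ : betaFun n x ≠ 0) (k : Fin (n+1)) :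
    uMap n x k = (q n x).im / (2 * betaFun n x) * (x k).re
      + -(betaFun n x ^ 2 + (q n x).re) / (2 * betaFun n x) * (x k).im := by
  simp only [uMap, Complex.mul_im, Complex.conj_re, Complex.conj_im]
  field_simp
  ring

theorem vMap_eq {n : ℕ} {x : Fin (n+1) → ℂ} (hβ : betaFun n x ≠ 0) (hs : √(hFun n x) ≠ 0)
    (k : Fin (n+1)) :
    vMap n x k = (betaFun n x ^ 2 - (q n x).re) / (√(hFun n x) * betaFun n x) * (x k).re
      + -(q n x).im / (√(hFun n x) * betaFun n x) * (x k).im := by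
  simp only [vMap, Complex.mul_re, Complex.conj_re, Complex.conj_im]
  field_simp
  ring

theorem sum_uMap_sq {n : ℕ} {x : Fin (n+1) → ℂ} (hx : x ∉ SigmaCone n) :
    ∑ k, uMap n x k ^ 2 = (√(hFun n x) / 2) ^ 2 := by
  have hβ := (betaFun_pos hx).ne'
  have hs := (Real.sq_sqrt (hFun_pos hx).le).trans (hFun_eq n x)
  have hb := betaFun_sq n x
  simp only [uMap_eq hβ, sum_linear_comb_sq]
  rw [q_re, q_im]
  generalize √(hFun n x) = s at *
  generalize betaFun n x = β at *
  generalize ∑ k, (x k).re ^ 2 = A at *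
  generalize ∑ k, (x k).im ^ 2 = B at *
  generalize ∑ k, (x k).re * (x k).im = C at *
  field_simp
  rw [hb]
  linear_combination -(A + s) * hs

theorem sum_vMap_sq {n : ℕ} {x : Fin (n+1) → ℂ} (hx : x ∉ SigmaCone n) :
    ∑ k, vMap n x k ^ 2 = 1 := by
  have hβ := (betaFun_pos hx).ne'
  have hs0 := (Real.sqrt_pos.2 (hFun_pos hx)).ne'
  have hs := (Real.sq_sqrt (hFun_pos hx).le).trans (hFun_eq n x)
  have hb := betaFun_sq n x
  simp only [vMap_eq hβ hs0, sum_linear_comb_sq]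
  rw [q_re, q_im]
  generalize √(hFun n x) = s at *
  generalize betaFun n x = β at *
  generalize ∑ k, (x k).re ^ 2 = A at *
  generalize ∑ k, (x k).im ^ 2 = B at *
  generalize ∑ k, (x k).re * (x k).im = C at *
  field_simp
  rw [hb]
  linear_combination -(B + s) * hs

theorem sum_uMap_mul_vMap {n : ℕ} {x : Fin (n+1) → ℂ} (hx : x ∉ SigmaCone n) :
    ∑ k, uMap n x k * vMap n x k = 0 := by
  have hβ := (betaFun_pos hx).ne'
  have hs0 := (Real.sqrt_pos.2 (hFun_pos hx)).ne'
  have hs := (Real.sq_sqrt (hFun_pos hx).le).trans (hFun_eq n x)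
  have hb := betaFun_sq n x
  simp only [uMap_eq hβ, vMap_eq hβ hs0, sum_linear_comb_mul]
  rw [q_re, q_im]
  generalize √(hFun n x) = s at *
  generalize betaFun n x = β at *
  generalize ∑ k, (x k).re ^ 2 = A at *
  generalize ∑ k, (x k).im ^ 2 = B at *
  generalize ∑ k, (x k).re * (x k).im = C at *
  field_simp
  rw [hb]
  linear_combination (-C) * hs

theorem sqrt_sum_uMap_sq {n : ℕ} {x : Fin (n+1) → ℂ} (hx : x ∉ SigmaCone n) :
    √(∑ k, uMap n x k ^ 2) = 1 / 2 * √(hFun n x) := by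
  rw [sum_uMap_sq hx, Real.sqrt_sq (by positivity)]
  ring

theorem mapsTo_Phi (n : ℕ) : Set.MapsTo (Phi n) (SigmaCone n)ᶜ
    {p : ℂ × (Fin (n+1) → ℝ) × (Fin (n+1) → ℝ) | p.2 ∈ TBundle n ∧ p.2.1 ≠ 0} := by
  refine fun x hx => ⟨⟨sum_uMap_mul_vMap hx, sum_vMap_sq hx⟩, fun (h0 : uMap n x = 0) => ?_⟩
  have hs := Real.sqrt_pos.2 (hFun_pos hx)
  have h := sum_uMap_sq hx
  simp only [h0, Pi.zero_apply, ne_eq, two_ne_zero, not_false_eq_true, zero_pow,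
    Finset.sum_const_zero] at h
  exact (by positivity : (√(hFun n x) / 2) ^ 2 ≠ 0) h.symm

/-- The inverse of `Φ`, written with parameters `z = q(x)`, `β = β(x)` and `s = h(x)^{1/2}`. -/
def invPhi {ι : Type*} (z : ℂ) (β s : ℝ) (u v : ι → ℝ) (k : ι) : ℂ :=
  ⟨-(z.im / (s * β)) * u k + (β ^ 2 + z.re) / (2 * β) * v k,
    -((β ^ 2 - z.re) / (s * β)) * u k + z.im / (2 * β) * v k⟩

theorem betaFun_pow_four {n : ℕ} {x : Fin (n+1) → ℂ} (hx : x ∉ SigmaCone n) :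
    betaFun n x ^ 4 =
      (q n x).re ^ 2 + (q n x).im ^ 2 + 2 * √(hFun n x) * betaFun n x ^ 2 := by
  have hs := (Real.sq_sqrt (hFun_pos hx).le).trans (hFun_eq n x)
  rw [show betaFun n x ^ 4 = (betaFun n x ^ 2) ^ 2 by ring, betaFun_sq, q_re, q_im]
  linear_combination -hs

theorem invPhi_Phi {n : ℕ} {x : Fin (n+1) → ℂ} (hx : x ∉ SigmaCone n) :
    invPhi (q n x) (betaFun n x) √(hFun n x) (uMap n x) (vMap n x) = x := by
  have hβ := (betaFun_pos hx).ne'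
  have hs0 := (Real.sqrt_pos.2 (hFun_pos hx)).ne'
  have hd := betaFun_pow_four hx
  funext k
  refine Complex.ext ?_ ?_ <;>
  · simp only [invPhi, uMap_eq hβ, vMap_eq hβ hs0]
    generalize √(hFun n x) = s at *
    generalize betaFun n x = β at *
    field_simp
    first
    | linear_combination (x k).re * hd
    | linear_combination (x k).im * hd

theorem injOn_Phi (n : ℕ) : Set.InjOn (Phi n) (SigmaCone n)ᶜ := by
  intro x hx y hy hxy
  simp only [Phi, Prod.mk.injEq] at hxy
  obtain ⟨hq, hu, hv⟩ := hxy
  have hh : √(hFun n x) = √(hFun n y) := by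
    linarith [sqrt_sum_uMap_sq hx, sqrt_sum_uMap_sq hy, congrArg (fun u => √(∑ k, u k ^ 2)) hu]
  have hh' : hFun n x = hFun n y := (Real.sqrt_inj (hFun_pos hx).le (hFun_pos hy).le).1 hh
  have hβ : betaFun n x = betaFun n y := by rw [betaFun_eq, betaFun_eq, hq, hh']
  rw [← invPhi_Phi hx, ← invPhi_Phi hy, hq, hu, hv, hβ, hh]

theorem surjOn_Phi (n : ℕ) : Set.SurjOn (Phi n) (SigmaCone n)ᶜ
    {p : ℂ × (Fin (n+1) → ℝ) × (Fin (n+1) → ℝ) | p.2 ∈ TBundle n ∧ p.2.1 ≠ 0} := by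
  rintro ⟨z, u, v⟩ ⟨⟨huv, hv⟩, hu⟩
  simp only at huv hv hu
  have hU : 0 < ∑ k, u k ^ 2 := by
    obtain ⟨k, hk⟩ := Function.ne_iff.1 hu
    exact Finset.sum_pos' (fun _ _ => sq_nonneg _) ⟨k, Finset.mem_univ k, sq_pos_of_ne_zero hk⟩
  obtain ⟨s, hs, hsU⟩ : ∃ s : ℝ, 0 < s ∧ ∑ k, u k ^ 2 = s ^ 2 / 4 :=
    ⟨2 * √(∑ k, u k ^ 2), by positivity, by rw [mul_pow, Real.sq_sqrt hU.le]; ring⟩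
  obtain ⟨N, hN, hNsq⟩ : ∃ N : ℝ, 0 ≤ N ∧ N ^ 2 = z.re ^ 2 + z.im ^ 2 + s ^ 2 :=
    ⟨√(z.re ^ 2 + z.im ^ 2 + s ^ 2), Real.sqrt_nonneg _, Real.sq_sqrt (by positivity)⟩
  obtain ⟨β, hβ, hβN⟩ : ∃ β : ℝ, 0 < β ∧ β ^ 2 = N + s :=
    ⟨√(N + s), Real.sqrt_pos.2 (by positivity), Real.sq_sqrt (by positivity)⟩
  set x := invPhi z β s u v with hx
  have hA : ∑ k, (x k).re ^ 2 = (N + z.re) / 2 := by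
    simp only [hx, invPhi, sum_linear_comb_sq, huv, hv, hsU]
    field_simp
    rw [hβN]
    linear_combination -4 * s * hNsq
  have hB : ∑ k, (x k).im ^ 2 = (N - z.re) / 2 := by
    simp only [hx, invPhi, sum_linear_comb_sq, huv, hv, hsU]
    field_simp
    rw [hβN]
    linear_combination -4 * s * hNsq
  have hC : ∑ k, (x k).re * (x k).im = z.im / 2 := by
    simp only [hx, invPhi, sum_linear_comb_mul, huv, hv, hsU]
    field_simp
    ring
  have hq : q n x = z :=
    Complex.ext (by rw [q_re, hA, hB]; ring) (by rw [q_im, hC]; ring)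
  have hh : hFun n x = s ^ 2 := by
    rw [hFun_eq, hA, hB, hC]
    linear_combination hNsq
  have hsqrt : √(hFun n x) = s := by rw [hh, Real.sqrt_sq hs.le]
  have hb : betaFun n x = β := by
    rw [betaFun, hsqrt, sum_normSq_eq, hA, hB, ← Real.sqrt_sq hβ.le, hβN]
    congr 1
    ring
  have hd : β ^ 4 = z.re ^ 2 + z.im ^ 2 + 2 * s * β ^ 2 := by
    rw [show β ^ 4 = (β ^ 2) ^ 2 by ring, hβN]
    linear_combination hNsq
  refine ⟨x, fun hmem => ?_, ?_⟩
  · rw [hFun_eq_zero_of_mem_SigmaCone hmem] at hh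
    exact (pow_pos hs 2).ne hh
  · refine Prod.ext hq (Prod.ext (funext fun k => ?_) (funext fun k => ?_))
    · change uMap n x k = u k
      rw [uMap_eq (hb ▸ hβ.ne'), hb, hq, hx]
      simp only [invPhi]
      field_simp
      linear_combination 2 * u k * hd
    · change vMap n x k = v k
      rw [vMap_eq (hb ▸ hβ.ne') (hsqrt ▸ hs.ne'), hb, hq, hsqrt, hx]
      simp only [invPhi]
      field_simp
      linear_combination s * v k * hd

theorem trivialization_of_quadratic_fibration (n : ℕ) :
    (∀ x ∉ SigmaCone n, 0 < hFun n x ∧ 0 < betaFun n x) ∧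
    Set.BijOn (Phi n) (SigmaCone n)ᶜ
      {p : ℂ × (Fin (n+1) → ℝ) × (Fin (n+1) → ℝ) | p.2 ∈ TBundle n ∧ p.2.1 ≠ 0} ∧
    ∀ x ∉ SigmaCone n,
      Real.sqrt (∑ k, (uMap n x k)^2) = (1/2) * Real.sqrt (hFun n x) :=
  ⟨fun _ hx => ⟨hFun_pos hx, betaFun_pos hx⟩,
    ⟨mapsTo_Phi n, injOn_Phi n, surjOn_Phi n⟩, fun _ hx => sqrt_sum_uMap_sq hx⟩

end
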